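/- If a digraph G satisfies condition L1 or condition L2, then G is not (≤6)-half-reconstructible. -/

import Mathlib

universe u v

/-- A digraph: an irreflexive binary relation on a vertex type. -/
structure Dgraph (V : Type u) where
  Arc : V → V → Prop
  irrefl : ∀ x, ¬ Arc x x

namespace Dgraph

variable {V : Type u} {W : Type v}

/-- The dual digraph. -/
def dual (G : Dgraph V) : Dgraph V :=
  ⟨fun x y => G.Arc y x, fun x h => G.irrefl x h⟩

/-- Subdigraph induced by a set of vertices. -/
def ind (G : Dgraph V) (X : Set V) : Dgraph X :=
  ⟨fun x y => G.Arc x y, fun x h => G.irrefl x h⟩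

/-- Isomorphism of digraphs. -/
def Iso (G : Dgraph V) (G' : Dgraph W) : Prop :=
  ∃ e : V ≃ W, ∀ x y, G.Arc x y ↔ G'.Arc (e x) (e y)

/-- `G` and `G'` are hemimorphic: `G'` is isomorphic to `G` or to its dual. -/
def Hemi (G : Dgraph V) (G' : Dgraph W) : Prop :=
  Iso G G' ∨ Iso G.dual G'

/-- Self-dual digraph. -/
def SelfDual (G : Dgraph V) : Prop := Iso G G.dual

/-- `{x,y}` is a directed pair. -/
def Dir (G : Dgraph V) (x y : V) : Prop :=
  (G.Arc x y ∧ ¬ G.Arc y x) ∨ (G.Arc y x ∧ ¬ G.Arc x y)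

/-- `{x,y}` is a neutral pair (full or void). -/
def Neutral (G : Dgraph V) (x y : V) : Prop :=
  x ≠ y ∧ ¬ G.Dir x y

/-- Interval of a digraph. -/
def IsInterval (G : Dgraph V) (I : Set V) : Prop :=
  ∀ x ∉ I,
    (∀ y ∈ I, G.Arc x y ∧ ¬ G.Arc y x) ∨ (∀ y ∈ I, G.Arc y x ∧ ¬ G.Arc x y) ∨
    (∀ y ∈ I, G.Arc x y ∧ G.Arc y x) ∨ (∀ y ∈ I, ¬ G.Arc x y ∧ ¬ G.Arc y x)

/-- The arc-connectivity equivalence relation. -/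
def ACRel (G : Dgraph V) : V → V → Prop := Relation.ReflTransGen G.Dir

/-- Arc-connected components. -/
def IsACComponent (G : Dgraph V) (D : Set V) : Prop :=
  ∃ x, D = {y | G.ACRel x y}

/-- Arc-connected digraph (at most one arc-connected component). -/
def ArcConnected (G : Dgraph V) : Prop := ∀ x y, G.ACRel x y

/-- Tournament. -/
def IsTournament (G : Dgraph V) : Prop := ∀ x y, x ≠ y → G.Dir x y

/-- Chain (transitive tournament). -/
def IsChainD (G : Dgraph V) : Prop :=
  G.IsTournament ∧ ∀ x y z, G.Arc x y → G.Arc y z → G.Arc x z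

/-- Dgraph from a relation, with forced irreflexivity. -/
def ofRel (r : V → V → Prop) : Dgraph V := ⟨fun x y => x ≠ y ∧ r x y, fun x h => h.1 rfl⟩

/-- The model flag. -/
def flagD : Dgraph (Fin 3) :=
  ofRel (fun x y => (x = 0 ∧ y = 1) ∨ (x = 1 ∧ y = 2) ∨ (x = 2 ∧ y = 1))

/-- First model peak. -/
def peakD1 : Dgraph (Fin 3) :=
  ofRel (fun x y => (x = 0 ∧ y = 1) ∨ (x = 0 ∧ y = 2) ∨ (x = 1 ∧ y = 2) ∨ (x = 2 ∧ y = 1))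

/-- Second model peak. -/
def peakD2 : Dgraph (Fin 3) :=
  ofRel (fun x y => (x = 0 ∧ y = 1) ∨ (x = 0 ∧ y = 2))

/-- The model diamond. -/
def diamondD : Dgraph (Fin 4) :=
  ofRel (fun x y => (x = 0 ∧ y = 1) ∨ (x = 0 ∧ y = 2) ∨ (x = 0 ∧ y = 3) ∨
    (x = 1 ∧ y = 2) ∨ (x = 2 ∧ y = 3) ∨ (x = 3 ∧ y = 1))

/-- A flag is a digraph hemimorphic to the model flag. -/
def IsFlag (G : Dgraph V) : Prop := Hemi G flagD

/-- A peak is a digraph hemimorphic to one of the two model peaks. -/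
def IsPeak (G : Dgraph V) : Prop := Hemi G peakD1 ∨ Hemi G peakD2

/-- A diamond is a digraph hemimorphic to the model diamond. -/
def IsDiamond (G : Dgraph V) : Prop := Hemi G diamondD

/-- Prechain: embeds no peak, no diamond, no two adjacent neutral pairs. -/
def IsPrechain (G : Dgraph V) : Prop :=
  (∀ X : Set V, ¬ IsPeak (G.ind X)) ∧ (∀ X : Set V, ¬ IsDiamond (G.ind X)) ∧
  ¬ ∃ x y z : V, y ≠ z ∧ G.Neutral x y ∧ G.Neutral x z

/-- Proper prechain: a prechain which is not a chain. -/
def ProperPrechain (G : Dgraph V) : Prop := G.IsPrechain ∧ ¬ G.IsChainD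

/-- Diamond-free tournament. -/
def DiamondFreeTournament (G : Dgraph V) : Prop :=
  G.IsTournament ∧ ∀ X : Set V, ¬ IsDiamond (G.ind X)

/-- Non-tournament prechain. -/
def NonTournamentPrechain (G : Dgraph V) : Prop := G.IsPrechain ∧ ¬ G.IsTournament

/-- Model finite consecutivity on `n` vertices (`full` decides whether the
non-consecutive pairs are all full or all void). -/
def consecFin (n : ℕ) (full : Bool) : Dgraph (Fin n) :=
  ofRel (fun i j => i.1 + 1 = j.1 ∨ (full = true ∧ (i.1 + 1 < j.1 ∨ j.1 + 1 < i.1)))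

/-- Model consecutivity of type ω. -/
def consecNat (full : Bool) : Dgraph ℕ :=
  ofRel (fun i j => i + 1 = j ∨ (full = true ∧ (i + 1 < j ∨ j + 1 < i)))

/-- Model consecutivity of type ω*+ω. -/
def consecInt (full : Bool) : Dgraph ℤ :=
  ofRel (fun i j => i + 1 = j ∨ (full = true ∧ (i + 1 < j ∨ j + 1 < i)))

/-- One-end infinite consecutivity (obtained from ω or ω*). -/
def OneEndInfiniteConsecutivity (G : Dgraph V) : Prop :=
  ∃ full, Iso G (consecNat full) ∨ Iso G (consecNat full).dual

/-- Consecutivity. -/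
def IsConsecutivity (G : Dgraph V) : Prop :=
  (∃ n, 3 ≤ n ∧ ∃ full, Iso G (consecFin n full)) ∨
  G.OneEndInfiniteConsecutivity ∨ (∃ full, Iso G (consecInt full))

/-- Model cycle on `n ≥ 3` vertices obtained from the finite consecutivity by
replacing the neutral pair `{0, n-1}` by the arc `(n-1, 0)`. -/
def cycleD (n : ℕ) (full : Bool) : Dgraph (Fin n) :=
  ofRel (fun i j => i.1 + 1 = j.1 ∨ (i.1 = n - 1 ∧ j.1 = 0) ∨
    (full = true ∧ (i.1 + 1 < j.1 ∨ j.1 + 1 < i.1) ∧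
      ¬ (i.1 = 0 ∧ j.1 = n - 1) ∧ ¬ (i.1 = n - 1 ∧ j.1 = 0)))

/-- Cycle. -/
def IsCycle (G : Dgraph V) : Prop := ∃ n, 3 ≤ n ∧ ∃ full, Iso G (cycleD n full)

/-- Near-chain: obtained from a chain by exchanging the directed pair formed
by its extremities. -/
def IsNearChain (G : Dgraph V) : Prop :=
  ∃ (H : Dgraph V) (m M : V), H.IsChainD ∧ m ≠ M ∧
    (∀ x, x ≠ m → H.Arc m x) ∧ (∀ x, x ≠ M → H.Arc x M) ∧
    (∀ x y, G.Arc x y ↔ ((H.Arc x y ∧ ¬ (x = m ∧ y = M)) ∨ (x = M ∧ y = m)))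

/-- `{k}`-hypomorphy. -/
def KHypo (k : ℕ) (G G' : Dgraph V) : Prop :=
  ∀ X : Set V, X.Finite → X.ncard = k → Iso (G.ind X) (G'.ind X)

/-- `(≤ k)`-hypomorphy. -/
def LeHypo (k : ℕ) (G G' : Dgraph V) : Prop :=
  ∀ j, 1 ≤ j → j ≤ k → KHypo j G G'

/-- `{k}`-hemimorphy. -/
def KHemi (k : ℕ) (G G' : Dgraph V) : Prop :=
  ∀ X : Set V, X.Finite → X.ncard = k → Hemi (G.ind X) (G'.ind X)

/-- `(≤ k)`-hemimorphy. -/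
def LeHemi (k : ℕ) (G G' : Dgraph V) : Prop :=
  ∀ j, 1 ≤ j → j ≤ k → KHemi j G G'

/-- `(≤ k)`-half-reconstructibility. -/
def HalfRecon (k : ℕ) (G : Dgraph V) : Prop :=
  ∀ G' : Dgraph V, LeHemi k G G' → Hemi G G'

/-- One step of the difference relation. -/
def DiffStep (G G' : Dgraph V) (x y : V) : Prop := G.Arc x y ↔ ¬ G'.Arc x y

/-- The difference relation `𝔇_{G,G'}`. -/
def DiffRel (G G' : Dgraph V) (x y : V) : Prop :=
  x = y ∨ Relation.TransGen (DiffStep G G') x y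

/-- Difference classes: `C ∈ D_{G,G'}`. -/
def DiffClass (G G' : Dgraph V) (C : Set V) : Prop :=
  ∃ x, C = {y | DiffRel G G' x y}

/-- The difference relation has at least two equivalence classes. -/
def AtLeastTwoDiffClasses (G G' : Dgraph V) : Prop :=
  ∃ C₁ C₂ : Set V, DiffClass G G' C₁ ∧ DiffClass G G' C₂ ∧ C₁ ≠ C₂

/-- `C_dual(G)`: the smallest cardinality of a finite set of vertices inducing a
non-self-dual subdigraph (`⊤` if there is none). -/
noncomputable def Cdual (G : Dgraph V) : ℕ∞ :=
  sInf {n : ℕ∞ | ∃ X : Set V, X.Finite ∧ ¬ SelfDual (G.ind X) ∧ n = (X.ncard : ℕ∞)}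

/-- The contracted digraph `G_I` (the vertex `none` plays the role of `I`). -/
def contract (G : Dgraph V) (I : Set V) : Dgraph (Option {x : V // x ∉ I}) where
  Arc := fun a b =>
    match a, b with
    | some x, some y => G.Arc x.1 y.1
    | some x, none => ∃ z ∈ I, G.Arc x.1 z
    | none, some y => ∃ z ∈ I, G.Arc z y.1
    | none, none => False
  irrefl := by
    rintro (_ | ⟨x, hx⟩)
    · simp
    · exact G.irrefl x

/-- There is an isomorphism `f` from `G_I` onto `G'_I` with `f(I) = I`. -/
def ContractIsoFix (G G' : Dgraph V) (I : Set V) : Prop :=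
  ∃ e : Option {x : V // x ∉ I} ≃ Option {x : V // x ∉ I},
    e none = none ∧ ∀ a b, (G.contract I).Arc a b ↔ (G'.contract I).Arc (e a) (e b)

/-- `D` is disjoint from every flag of `G`. -/
def FlagDisjoint (G : Dgraph V) (D : Set V) : Prop :=
  ∀ F : Set V, IsFlag (G.ind F) → D ∩ F = ∅

/-- `D` contains a vertex `a` of a flag `{a,b,c}` of `G` with `b, c ∉ D` and
`{b,c}` the directed pair of the flag. -/
def FlagVertexCond (G : Dgraph V) (D : Set V) : Prop :=
  ∃ a ∈ D, ∃ b c : V, b ∉ D ∧ c ∉ D ∧ IsFlag (G.ind {a, b, c}) ∧ G.Dir b c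

/-- Condition `C_∞`. -/
def CondCinf (G : Dgraph V) : Prop :=
  (∃ I : Set V, I.Infinite ∧ G.IsInterval I ∧ (G.ind I).IsChainD) ∨
  (∃ I J : Set V, I ≠ J ∧ G.IsInterval I ∧ G.IsInterval J ∧
     (G.ind I).OneEndInfiniteConsecutivity ∧ (G.ind J).OneEndInfiniteConsecutivity) ∨
  (∃ I : Set V, G.IsInterval I ∧ (G.ind I).OneEndInfiniteConsecutivity ∧
     (∀ J : Set V, G.IsInterval J → (G.ind J).OneEndInfiniteConsecutivity → J = I) ∧
     ¬ ContractIsoFix G G.dual I)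

/-- The kind of component occurring in conditions `K1` and `K2`. -/
def K12Kind (G : Dgraph V) (D : Set V) : Prop :=
  DiamondFreeTournament (G.ind D) ∨ (NonTournamentPrechain (G.ind D) ∧ G.FlagDisjoint D)

/-- Condition `K1`. -/
def CondK1 (G : Dgraph V) : Prop :=
  G.Cdual = 3 ∧ ∃ D₁ D₂ : Set V, D₁ ≠ D₂ ∧
    (G.IsACComponent D₁ ∧ ¬ SelfDual (G.ind D₁) ∧ G.IsInterval D₁ ∧ G.K12Kind D₁) ∧
    (G.IsACComponent D₂ ∧ ¬ SelfDual (G.ind D₂) ∧ G.IsInterval D₂ ∧ G.K12Kind D₂)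

/-- Condition `K2`. -/
def CondK2 (G : Dgraph V) : Prop :=
  G.Cdual = 3 ∧ ∃ D₀ : Set V, G.IsACComponent D₀ ∧ ¬ SelfDual (G.ind D₀) ∧
    (∀ D, G.IsACComponent D → ¬ SelfDual (G.ind D) → D = D₀) ∧
    G.K12Kind D₀ ∧ ¬ ContractIsoFix G G.dual D₀

/-- Condition `K3`. -/
def CondK3 (G : Dgraph V) : Prop :=
  G.Cdual = 4 ∧ ∃ D₁ D₂ : Set V, D₁ ≠ D₂ ∧
    (G.IsACComponent D₁ ∧ ¬ SelfDual (G.ind D₁) ∧ G.IsInterval D₁) ∧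
    (G.IsACComponent D₂ ∧ ¬ SelfDual (G.ind D₂) ∧ G.IsInterval D₂)

/-- Condition `K4`. -/
def CondK4 (G : Dgraph V) : Prop :=
  G.Cdual = 5 ∧ ∃ D₁ D₂ : Set V, D₁ ≠ D₂ ∧
    (G.IsACComponent D₁ ∧ ¬ SelfDual (G.ind D₁) ∧ G.IsInterval D₁ ∧ IsPrechain (G.ind D₁)) ∧
    (G.IsACComponent D₂ ∧ ¬ SelfDual (G.ind D₂) ∧ G.IsInterval D₂ ∧ IsPrechain (G.ind D₂))

/-- Condition `K5`. -/
def CondK5 (G : Dgraph V) : Prop :=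
  G.Cdual = 6 ∧ ∃ D₁ D₂ : Set V, D₁ ≠ D₂ ∧
    (G.IsACComponent D₁ ∧ ¬ SelfDual (G.ind D₁) ∧ G.IsInterval D₁ ∧
      DiamondFreeTournament (G.ind D₁)) ∧
    (G.IsACComponent D₂ ∧ ¬ SelfDual (G.ind D₂) ∧ G.IsInterval D₂ ∧
      DiamondFreeTournament (G.ind D₂))

/-- The kind of interval occurring in conditions `L1` and `L2`. -/
def L12Int (G : Dgraph V) (I : Set V) : Prop :=
  G.IsInterval I ∧ DiamondFreeTournament (G.ind I) ∧ ¬ SelfDual (G.ind I) ∧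
    ¬ G.IsACComponent I

/-- Condition `L1`. -/
def CondL1 (G : Dgraph V) : Prop :=
  ∃ I₁ I₂ : Set V, I₁ ≠ I₂ ∧ G.L12Int I₁ ∧ G.L12Int I₂

/-- Condition `L2`. -/
def CondL2 (G : Dgraph V) : Prop :=
  ∃ I₀ : Set V, G.L12Int I₀ ∧ (∀ I, G.L12Int I → I = I₀) ∧ ¬ ContractIsoFix G G.dual I₀

/-- Condition `L3`. -/
def CondL3 (G : Dgraph V) : Prop :=
  G.Cdual = 3 ∧ ∃ D₁ D₂ : Set V, D₁ ≠ D₂ ∧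
    (G.IsACComponent D₁ ∧ ¬ SelfDual (G.ind D₁) ∧ G.IsInterval D₁) ∧
    (G.IsACComponent D₂ ∧ ¬ SelfDual (G.ind D₂) ∧ G.IsInterval D₂) ∧
    ((G.FlagDisjoint D₁ ∧ Cdual (G.ind D₁) = 4 ∧ G.FlagDisjoint D₂ ∧ Cdual (G.ind D₂) = 4) ∨
     (NonTournamentPrechain (G.ind D₁) ∧ G.FlagVertexCond D₁ ∧
      NonTournamentPrechain (G.ind D₂) ∧ G.FlagVertexCond D₂))

/-- Condition `L4`. -/
def CondL4 (G : Dgraph V) : Prop :=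
  G.Cdual = 3 ∧ ∃ D₀ : Set V, G.IsACComponent D₀ ∧ ¬ SelfDual (G.ind D₀) ∧
    (∀ D, G.IsACComponent D → ¬ SelfDual (G.ind D) → D = D₀) ∧
    G.IsInterval D₀ ∧
    ((G.FlagDisjoint D₀ ∧ Cdual (G.ind D₀) = 4) ∨
     (NonTournamentPrechain (G.ind D₀) ∧ G.FlagVertexCond D₀)) ∧
    ¬ ContractIsoFix G G.dual D₀

end Dgraph


namespace Dgraph

section Isomorphism

variable {V : Type u} {W : Type v}

theorem Iso.symm {G : Dgraph V} {G' : Dgraph W} (h : Iso G G') : Iso G' G := by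
  obtain ⟨e, he⟩ := h
  exact ⟨e.symm, fun x y => by simp [he]⟩

theorem Iso.trans {U : Type*} {G : Dgraph V} {G' : Dgraph W} {G'' : Dgraph U}
    (h : Iso G G') (h' : Iso G' G'') : Iso G G'' := by
  obtain ⟨e, he⟩ := h
  obtain ⟨f, hf⟩ := h'
  exact ⟨e.trans f, fun x y => by simp [he, hf]⟩

theorem Iso.dual {G : Dgraph V} {G' : Dgraph W} (h : Iso G G') : Iso G.dual G'.dual := by
  obtain ⟨e, he⟩ := h
  exact ⟨e, fun x y => he y x⟩

theorem Hemi.symm {G : Dgraph V} {G' : Dgraph W} (h : Hemi G G') : Hemi G' G :=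
  h.imp Iso.symm fun h => h.symm.dual

theorem Hemi.trans {U : Type*} {G : Dgraph V} {G' : Dgraph W} {G'' : Dgraph U}
    (h : Hemi G G') (h' : Hemi G' G'') : Hemi G G'' := by
  rcases h with h | h <;> rcases h' with h' | h'
  · exact .inl (h.trans h')
  · exact .inr (h.dual.trans h')
  · exact .inr (h.trans h')
  · exact .inl (h.dual.trans h')

theorem not_halfRecon_of_not_hemi {k : ℕ} {G G₁ G₂ : Dgraph V} (h₁ : LeHemi k G G₁)
    (h₂ : LeHemi k G G₂) (h : ¬ Hemi G₁ G₂) : ¬ G.HalfRecon k :=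
  fun hG => h ((hG G₁ h₁).symm.trans (hG G₂ h₂))

theorem iso_ind_preimage {G : Dgraph V} {G' : Dgraph W} (e : V ≃ W)
    (he : ∀ x y, G.Arc x y ↔ G'.Arc (e x) (e y)) (J : Set W) :
    Iso (G.ind (e ⁻¹' J)) (G'.ind J) :=
  ⟨e.subtypeEquiv fun _ => Iff.rfl, fun x y => he x y⟩

theorem iso_ind_of_forall {G G' : Dgraph V} {X : Set V}
    (h : ∀ x ∈ X, ∀ y ∈ X, G.Arc x y ↔ G'.Arc x y) : Iso (G.ind X) (G'.ind X) :=
  ⟨Equiv.refl _, fun x y => h x x.2 y y.2⟩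

theorem iso_ind_range {G : Dgraph V} {H : Dgraph W} {f : W → V} (hH : H.IsTournament)
    (hf : ∀ i j, G.Arc (f i) (f j) ↔ H.Arc i j) : Iso (G.ind (Set.range f)) H := by
  have hinj : f.Injective := by
    intro i j hij
    by_contra hne
    rcases hH i j hne with h | h
    · exact G.irrefl (f j) (hij ▸ (hf i j).2 h.1)
    · exact G.irrefl (f j) (hij ▸ (hf j i).2 h.1)
  refine Iso.symm ⟨Equiv.ofInjective f hinj, fun i j => (hf i j).symm⟩

/-- Isomorphisms between the parts cut out by the fibres of `c` glue together, provided that the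
fibres are intervals and that `G` and `G'` agree between distinct fibres. -/
theorem iso_ind_of_fibers {ι : Type*} {G G' : Dgraph V} (c : V → ι)
    (hagree : ∀ x y, c x ≠ c y → (G.Arc x y ↔ G'.Arc x y))
    (hunif : ∀ x y z, c x ≠ c y → c y = c z →
      (G.Arc x y ↔ G.Arc x z) ∧ (G.Arc y x ↔ G.Arc z x)) (X : Set V)
    (h : ∀ q, Iso (G.ind {x | x ∈ X ∧ c x = q}) (G'.ind {x | x ∈ X ∧ c x = q})) :
    Iso (G.ind X) (G'.ind X) := by
  choose e he using h
  let F : X → X := fun x => ⟨(e (c x) ⟨x.1, x.2, rfl⟩).1, (e (c x) ⟨x.1, x.2, rfl⟩).2.1⟩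
  have hFc : ∀ x, c (F x) = c x := fun x => (e (c x) ⟨x.1, x.2, rfl⟩).2.2
  have hFe : ∀ (x : X) q (hq : c x = q), (F x).1 = (e q ⟨x.1, x.2, hq⟩).1 := by
    rintro x q rfl
    rfl
  have hinj : F.Injective := by
    intro x y hxy
    have hc : c y = c x := by rw [← hFc x, ← hFc y, hxy]
    have h1 := hFe y _ hc
    rw [← hxy, hFe x _ rfl] at h1
    have h2 := (e (c x)).injective (Subtype.ext h1)
    exact Subtype.ext (congrArg (fun z => z.1) h2)
  have hsurj : F.Surjective := by
    intro y
    have hx := ((e (c y)).symm ⟨y.1, y.2, rfl⟩).2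
    refine ⟨⟨((e (c y)).symm ⟨y.1, y.2, rfl⟩).1, hx.1⟩, Subtype.ext ?_⟩
    rw [hFe _ (c y) hx.2]
    simp
  refine ⟨Equiv.ofBijective F ⟨hinj, hsurj⟩, fun x y => ?_⟩
  change G.Arc x y ↔ G'.Arc (F x) (F y)
  by_cases hxy : c x = c y
  · rw [hFe x (c y) hxy, hFe y _ rfl]
    exact he (c y) ⟨x.1, x.2, hxy⟩ ⟨y.1, y.2, rfl⟩
  · rw [← hagree (F x) (F y) (by rwa [hFc, hFc])]
    rw [(hunif x y (F y) hxy (hFc y).symm).1]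
    exact (hunif (F y) x (F x) (by rw [hFc]; exact Ne.symm hxy) (hFc x).symm).2

end Isomorphism

section Intervals

variable {V : Type u} {W : Type v}

theorem isInterval_iff {G : Dgraph V} {I : Set V} :
    G.IsInterval I ↔ ∀ x ∉ I, ∀ y ∈ I, ∀ z ∈ I,
      (G.Arc x y ↔ G.Arc x z) ∧ (G.Arc y x ↔ G.Arc z x) := by
  constructor
  · intro h x hx y hy z hz
    rcases h x hx with h | h | h | h <;> have h1 := h y hy <;> have h2 := h z hz <;> tauto
  · intro h x hx
    rcases I.eq_empty_or_nonempty with rfl | ⟨y, hy⟩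
    · simp
    · have h' := fun z hz => h x hx y hy z hz
      by_cases h1 : G.Arc x y <;> by_cases h2 : G.Arc y x <;> simp only [h1, h2] at h' <;> grind

theorem isInterval_preimage {G : Dgraph V} {G' : Dgraph W} (e : V ≃ W)
    (he : ∀ x y, G.Arc x y ↔ G'.Arc (e x) (e y)) {J : Set W} (hJ : G'.IsInterval J) :
    G.IsInterval (e ⁻¹' J) := by
  rw [isInterval_iff] at hJ ⊢
  intro x hx y hy z hz
  simpa only [he] using hJ (e x) hx (e y) hy (e z) hz

theorem IsInterval.dual {G : Dgraph V} {I : Set V} (h : G.IsInterval I) :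
    G.dual.IsInterval I := by
  rw [isInterval_iff] at h ⊢
  exact fun x hx y hy z hz => (h x hx y hy z hz).symm

/-- `I` induces a diamond-free tournament, spelled out on vertices. -/
def DiamondFreeOn (G : Dgraph V) (I : Set V) : Prop :=
  (∀ x ∈ I, ∀ y ∈ I, x ≠ y → G.Dir x y) ∧
  ∀ a ∈ I, ∀ b ∈ I, ∀ c ∈ I, ∀ d ∈ I, G.Arc b c → G.Arc c d → G.Arc d b →
    ¬ (G.Arc a b ∧ G.Arc a c ∧ G.Arc a d) ∧ ¬ (G.Arc b a ∧ G.Arc c a ∧ G.Arc d a)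

theorem DiamondFreeOn.dual {G : Dgraph V} {I : Set V} (h : G.DiamondFreeOn I) :
    G.dual.DiamondFreeOn I := by
  refine ⟨fun x hx y hy hxy => h.1 y hy x hx hxy.symm, fun a ha b hb c hc d hd h1 h2 h3 => ?_⟩
  have := h.2 a ha c hc b hb d hd h1 h3 h2
  simp only [Dgraph.dual]
  tauto

theorem DiamondFreeOn.mono {G : Dgraph V} {I J : Set V} (h : G.DiamondFreeOn I) (hJ : J ⊆ I) :
    G.DiamondFreeOn J :=
  ⟨fun x hx y hy => h.1 x (hJ hx) y (hJ hy),
    fun a ha b hb c hc d hd => h.2 a (hJ ha) b (hJ hb) c (hJ hc) d (hJ hd)⟩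

theorem DiamondFreeOn.congr {G G' : Dgraph V} {I : Set V} (h : G.DiamondFreeOn I)
    (hG : ∀ x ∈ I, ∀ y ∈ I, G'.Arc x y ↔ G.Arc x y) : G'.DiamondFreeOn I := by
  refine ⟨fun x hx y hy hxy => ?_, fun a ha b hb c hc d hd h1 h2 h3 => ?_⟩
  · have := h.1 x hx y hy hxy
    rwa [Dir, hG x hx y hy, hG y hy x hx]
  · have := h.2 a ha b hb c hc d hd
    simp only [hG a ha b hb, hG a ha c hc, hG a ha d hd, hG b hb a ha, hG c hc a ha, hG d hd a ha,
      hG b hb c hc, hG c hc d hd, hG d hd b hb] at h1 h2 h3 ⊢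
    exact this h1 h2 h3

theorem DiamondFreeOn.preimage {G : Dgraph V} {G' : Dgraph W} (e : V ≃ W)
    (he : ∀ x y, G.Arc x y ↔ G'.Arc (e x) (e y)) {J : Set W} (hJ : G'.DiamondFreeOn J) :
    G.DiamondFreeOn (e ⁻¹' J) := by
  refine ⟨fun x hx y hy hxy => ?_, fun a ha b hb c hc d hd h1 h2 h3 => ?_⟩
  · simpa only [Dir, he] using hJ.1 (e x) hx (e y) hy (e.injective.ne hxy)
  · simp only [he] at h1 h2 h3 ⊢
    exact hJ.2 _ ha _ hb _ hc _ hd h1 h2 h3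

theorem DiamondFreeOn.not_arc {G : Dgraph V} {I : Set V} (h : G.DiamondFreeOn I) {x y : V}
    (hx : x ∈ I) (hy : y ∈ I) (hxy : G.Arc x y) : ¬ G.Arc y x := by
  have hne : x ≠ y := by rintro rfl; exact G.irrefl x hxy
  rcases h.1 x hx y hy hne with h | h <;> tauto

theorem diamondD_isTournament : diamondD.IsTournament := by
  intro i j hij
  simp only [Dir, diamondD, ofRel]
  revert hij
  revert i j
  decide

theorem isDiamond_of_arcs {G : Dgraph V} (hG : G.IsTournament) {a b c d : V}
    (hab : G.Arc a b) (hac : G.Arc a c) (had : G.Arc a d) (hbc : G.Arc b c) (hcd : G.Arc c d)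
    (hdb : G.Arc d b) : Iso (G.ind (Set.range ![a, b, c, d])) diamondD := by
  have key : ∀ x y, G.Arc x y → ¬ G.Arc y x := by
    intro x y hxy
    have hne : x ≠ y := by rintro rfl; exact G.irrefl x hxy
    rcases hG x y hne with h | h <;> tauto
  refine iso_ind_range diamondD_isTournament fun i j => ?_
  fin_cases i <;> fin_cases j <;>
    simp [diamondD, ofRel, hab, hac, had, hbc, hcd, hdb, key _ _ hab, key _ _ hac, key _ _ had,
      key _ _ hbc, key _ _ hcd, key _ _ hdb, G.irrefl]

theorem DiamondFreeTournament.dual {G : Dgraph V} (h : G.DiamondFreeTournament) :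
    G.dual.DiamondFreeTournament :=
  ⟨fun x y hxy => h.1 y x hxy.symm, fun X hX => h.2 X (by
    rcases hX with hX | hX
    · exact .inr hX
    · exact .inl hX)⟩

theorem diamondFreeTournament_ind_iff {G : Dgraph V} {I : Set V} :
    DiamondFreeTournament (G.ind I) ↔ G.DiamondFreeOn I := by
  constructor
  · intro h
    refine ⟨fun x hx y hy hxy => h.1 ⟨x, hx⟩ ⟨y, hy⟩ (by simpa using hxy), ?_⟩
    intro a ha b hb c hc d hd hbc hcd hdb
    constructor
    · rintro ⟨h1, h2, h3⟩
      exact h.2 _ (.inl (isDiamond_of_arcs h.1 (a := ⟨a, ha⟩) (b := ⟨b, hb⟩) (c := ⟨c, hc⟩)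
        (d := ⟨d, hd⟩) h1 h2 h3 hbc hcd hdb))
    · rintro ⟨h1, h2, h3⟩
      exact h.dual.2 _ (.inl (isDiamond_of_arcs h.dual.1 (a := ⟨a, ha⟩) (b := ⟨b, hb⟩)
        (c := ⟨d, hd⟩) (d := ⟨c, hc⟩) h1 h3 h2 hdb hcd hbc))
  · intro h
    refine ⟨fun x y hxy => h.1 x x.2 y y.2 (fun h' => hxy (Subtype.ext h')), ?_⟩
    have key : ∀ X : Set I, ∀ e : X ≃ Fin 4,
        (∀ i j, diamondD.Arc i j → G.Arc (e.symm i).1.1 (e.symm j).1.1) ∨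
        (∀ i j, diamondD.Arc i j → G.Arc (e.symm j).1.1 (e.symm i).1.1) → False := by
      intro X e he
      have := h.2 _ (e.symm 0).1.2 _ (e.symm 1).1.2 _ (e.symm 2).1.2 _ (e.symm 3).1.2
      have := h.2 _ (e.symm 0).1.2 _ (e.symm 1).1.2 _ (e.symm 3).1.2 _ (e.symm 2).1.2
      simp only [diamondD, ofRel] at he
      rcases he with he | he
      · have h01 := he 0 1 (by decide)
        have h02 := he 0 2 (by decide)
        have h03 := he 0 3 (by decide)
        have h12 := he 1 2 (by decide)
        have h23 := he 2 3 (by decide)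
        have h31 := he 3 1 (by decide)
        tauto
      · have h01 := he 0 1 (by decide)
        have h02 := he 0 2 (by decide)
        have h03 := he 0 3 (by decide)
        have h12 := he 1 2 (by decide)
        have h23 := he 2 3 (by decide)
        have h31 := he 3 1 (by decide)
        tauto
    rintro X (⟨e, he⟩ | ⟨e, he⟩)
    · exact key X e (.inl fun i j hij => (he _ _).2 (by simpa using hij))
    · exact key X e (.inr fun i j hij => (he _ _).2 (by simpa using hij))

end Intervals

section FiveVertices

/-- The arc from `i` to `j` in the tournament on the natural numbers coded by the bits of `t`. -/
def tourArc (t i j : ℕ) : Bool :=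
  if i < j then t.testBit (j * (j - 1) / 2 + i)
  else if j < i then !(t.testBit (i * (i - 1) / 2 + j)) else false

/-- The products of two disjoint transpositions of `{0, 1, 2, 3, 4}`. -/
def doubleSwaps : List (ℕ × ℕ × ℕ × ℕ) :=
  [(0, 1, 2, 3), (0, 2, 1, 3), (0, 3, 1, 2), (0, 1, 2, 4), (0, 2, 1, 4), (0, 4, 1, 2),
   (0, 1, 3, 4), (0, 3, 1, 4), (0, 4, 1, 3), (0, 2, 3, 4), (0, 3, 2, 4), (0, 4, 2, 3),
   (1, 2, 3, 4), (1, 3, 2, 4), (1, 4, 2, 3)]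

/-- The permutation exchanging `p.1` with `p.2.1` and `p.2.2.1` with `p.2.2.2`. -/
def doubleSwap (p : ℕ × ℕ × ℕ × ℕ) (x : ℕ) : ℕ :=
  if x = p.1 then p.2.1 else if x = p.2.1 then p.1
  else if x = p.2.2.1 then p.2.2.2 else if x = p.2.2.2 then p.2.2.1 else x

/-- Whether the tournament coded by `t` has a diamond on the first `n` vertices. -/
def hasDiamond (n t : ℕ) : Bool :=
  (List.range n).any fun b => (List.range n).any fun c => tourArc t b c &&
    (List.range n).any fun d => tourArc t c d && tourArc t d b &&
      (List.range n).any fun a =>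
        (tourArc t a b && tourArc t a c && tourArc t a d) ||
        (tourArc t b a && tourArc t c a && tourArc t d a)

/-- Whether a double transposition reverses the tournament coded by `t` on `n` vertices. -/
def hasReversal (n t : ℕ) : Bool :=
  doubleSwaps.any fun p => (List.range n).all fun i => decide (doubleSwap p i < n) &&
    (List.range n).all fun j => tourArc t i j == tourArc t (doubleSwap p j) (doubleSwap p i)

theorem hasDiamond_or_hasReversal :
    ((List.range 6).all fun n => (List.range (2 ^ (n * (n - 1) / 2))).all fun t =>
      hasDiamond n t || hasReversal n t) = true := by
  decide +kernel

theorem exists_code (n : ℕ) (hn : n ≤ 5) (A : ℕ → ℕ → Bool) :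
    ∃ t < 2 ^ (n * (n - 1) / 2), ∀ i j, i < j → j < n →
      t.testBit (j * (j - 1) / 2 + i) = A i j := by
  refine ⟨Nat.ofBits fun k : Fin (n * (n - 1) / 2) =>
    A (![0, 0, 1, 0, 1, 2, 0, 1, 2, 3] (Fin.ofNat 10 k.1))
      (![1, 2, 2, 3, 3, 3, 4, 4, 4, 4] (Fin.ofNat 10 k.1)), Nat.ofBits_lt_two_pow _, ?_⟩
  intro i j hij hj
  have hlt : j * (j - 1) / 2 + i < n * (n - 1) / 2 := by
    interval_cases n <;> interval_cases j <;> omega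
  rw [Nat.testBit_ofBits_lt _ _ hlt]
  have hj5 : j < 5 := by omega
  interval_cases j <;> interval_cases i <;> rfl

variable {V : Type u}

theorem DiamondFreeOn.selfDual_ind {G : Dgraph V} {X : Set V} (h : G.DiamondFreeOn X)
    (hX : X.Finite) (hcard : X.ncard ≤ 5) : SelfDual (G.ind X) := by
  have := hX.to_subtype
  set n := X.ncard with hn
  have e : X ≃ Fin n := Finite.equivFinOfCardEq (Nat.card_coe_set_eq X)
  obtain ⟨t, ht, htb⟩ := exists_code n hcard fun i j => by
    classical exact decide (∃ (hi : i < n) (hj : j < n), G.Arc (e.symm ⟨i, hi⟩) (e.symm ⟨j, hj⟩))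
  have harc : ∀ i j : Fin n, tourArc t i j = true ↔ G.Arc (e.symm i) (e.symm j) := by
    intro i j
    unfold tourArc
    rcases lt_trichotomy i j with hij | rfl | hij
    · rw [if_pos (by exact hij), htb i j hij j.2]
      simp
    · simp [G.irrefl]
    · rw [if_neg (by simpa using hij.le), if_pos (by exact hij), htb j i hij i.2]
      have hne : (e.symm i).1 ≠ (e.symm j).1 := fun h' =>
        hij.ne' (e.symm.injective (Subtype.ext h'))
      have := h.1 _ (e.symm i).2 _ (e.symm j).2 hne
      simp only [Dir] at this
      simp
      tauto
  have hchk := hasDiamond_or_hasReversal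
  simp only [List.all_eq_true, List.mem_range, Bool.or_eq_true] at hchk
  have hchk := hchk n (by omega) t ht
  clear ht htb
  rcases hchk with hd | hr
  · exfalso
    simp only [hasDiamond, List.any_eq_true, List.mem_range, Bool.and_eq_true,
      Bool.or_eq_true] at hd
    obtain ⟨b, hb, c, hc, hbc, d, hd, ⟨hcd, hdb⟩, a, ha, hor⟩ := hd
    have := h.2 _ (e.symm ⟨a, ha⟩).2 _ (e.symm ⟨b, hb⟩).2 _ (e.symm ⟨c, hc⟩).2 _
      (e.symm ⟨d, hd⟩).2 ((harc ⟨b, hb⟩ ⟨c, hc⟩).1 hbc) ((harc ⟨c, hc⟩ ⟨d, hd⟩).1 hcd)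
      ((harc ⟨d, hd⟩ ⟨b, hb⟩).1 hdb)
    rcases hor with ⟨⟨h1, h2⟩, h3⟩ | ⟨⟨h1, h2⟩, h3⟩
    · exact this.1 ⟨(harc ⟨a, ha⟩ ⟨b, hb⟩).1 h1, (harc ⟨a, ha⟩ ⟨c, hc⟩).1 h2,
        (harc ⟨a, ha⟩ ⟨d, hd⟩).1 h3⟩
    · exact this.2 ⟨(harc ⟨b, hb⟩ ⟨a, ha⟩).1 h1, (harc ⟨c, hc⟩ ⟨a, ha⟩).1 h2,
        (harc ⟨d, hd⟩ ⟨a, ha⟩).1 h3⟩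
  · simp only [hasReversal, List.any_eq_true, List.all_eq_true, List.mem_range,
      Bool.and_eq_true, decide_eq_true_eq, beq_iff_eq] at hr
    obtain ⟨p, -, hp⟩ := hr
    let σ : Fin n → Fin n := fun i => ⟨doubleSwap p i, (hp i i.2).1⟩
    have hσ : ∀ i j, G.Arc (e.symm i) (e.symm j) ↔ G.Arc (e.symm (σ j)) (e.symm (σ i)) := by
      intro i j
      rw [← harc, ← harc, (hp i i.2).2 j j.2]
    have hinj : σ.Injective := by
      intro i j hij
      by_contra hne
      have hne' : (e.symm i).1 ≠ (e.symm j).1 := fun h' =>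
        hne (e.symm.injective (Subtype.ext h'))
      have := h.1 _ (e.symm i).2 _ (e.symm j).2 hne'
      simp only [Dir, hσ i j, hσ j i, hij, G.irrefl, false_and, or_self] at this
    refine ⟨(e.trans (Equiv.ofBijective σ (Finite.injective_iff_bijective.1 hinj))).trans e.symm,
      fun x y => ?_⟩
    change G.Arc x y ↔ G.Arc (e.symm (σ (e y))) (e.symm (σ (e x)))
    simpa using hσ (e x) (e y)

end FiveVertices

section Flip

variable {V : Type u} {W : Type v}

/-- The digraph obtained from `G` by dualizing each of the members of `S`. -/
def flip (G : Dgraph V) (S : Set (Set V)) : Dgraph V :=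
  ⟨fun x y => ((∃ M ∈ S, x ∈ M ∧ y ∈ M) ∧ G.Arc y x) ∨
    ((¬ ∃ M ∈ S, x ∈ M ∧ y ∈ M) ∧ G.Arc x y), fun x h => by
      rcases h with h | h <;> exact G.irrefl x h.2⟩

theorem flip_arc_of_mem {G : Dgraph V} {S : Set (Set V)} {M : Set V} (hM : M ∈ S) {x y : V}
    (hx : x ∈ M) (hy : y ∈ M) : (G.flip S).Arc x y ↔ G.Arc y x := by
  have : ∃ M ∈ S, x ∈ M ∧ y ∈ M := ⟨M, hM, hx, hy⟩
  exact ⟨fun h => h.elim And.right fun h => (h.1 this).elim, fun h => .inl ⟨this, h⟩⟩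

theorem flip_arc_of_not {G : Dgraph V} {S : Set (Set V)} {x y : V}
    (h : ∀ M ∈ S, x ∈ M → y ∉ M) : (G.flip S).Arc x y ↔ G.Arc x y := by
  have : ¬ ∃ M ∈ S, x ∈ M ∧ y ∈ M := fun ⟨M, hM, hx, hy⟩ => h M hM hx hy
  exact ⟨fun h => h.elim (fun h => (this h.1).elim) And.right, fun h => .inr ⟨this, h⟩⟩

theorem flip_dir (G : Dgraph V) (S : Set (Set V)) : (G.flip S).Dir = G.Dir := by
  funext x y
  by_cases h : ∃ M ∈ S, x ∈ M ∧ y ∈ M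
  · obtain ⟨M, hM, hx, hy⟩ := h
    simp only [Dir, flip_arc_of_mem hM hx hy, flip_arc_of_mem hM hy hx]
    exact propext or_comm
  · simp only [Dir]
    rw [flip_arc_of_not fun M hM hx hy => h ⟨M, hM, hx, hy⟩,
      flip_arc_of_not fun M hM hy hx => h ⟨M, hM, hx, hy⟩]

theorem flip_ind_of_mem {G : Dgraph V} {S : Set (Set V)} {M : Set V} (hM : M ∈ S) :
    Iso (G.ind M).dual ((G.flip S).ind M) :=
  ⟨Equiv.refl _, fun x y => (flip_arc_of_mem hM x.2 y.2).symm⟩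

theorem flip_ind_of_disjoint {G : Dgraph V} {S : Set (Set V)} {J : Set V}
    (h : ∀ M ∈ S, ∀ x ∈ J, x ∉ M) : Iso (G.ind J) ((G.flip S).ind J) :=
  iso_ind_of_forall fun x hx _ _ => (flip_arc_of_not fun M hM hxM => (h M hM x hx hxM).elim).symm

theorem flip_isInterval_of_mem {G : Dgraph V} {S : Set (Set V)}
    (hdisj : ∀ M ∈ S, ∀ N ∈ S, ∀ x ∈ M, x ∈ N → M = N) {M : Set V} (hM : M ∈ S)
    (hI : G.IsInterval M) : (G.flip S).IsInterval M := by
  rw [isInterval_iff] at hI ⊢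
  intro x hx y hy z hz
  have key : ∀ y ∈ M, ∀ N ∈ S, x ∈ N → y ∉ N := by
    intro y hy N hN hxN hyN
    exact hx (hdisj M hM N hN y hy hyN ▸ hxN)
  rw [flip_arc_of_not (key y hy), flip_arc_of_not (key z hz),
    flip_arc_of_not fun N hN h h' => key y hy N hN h' h,
    flip_arc_of_not fun N hN h h' => key z hz N hN h' h]
  exact hI x hx y hy z hz

theorem flip_isInterval_of_disjoint {G : Dgraph V} {S : Set (Set V)} {J : Set V}
    (h : ∀ M ∈ S, ∀ x ∈ J, x ∉ M) : (G.flip S).IsInterval J ↔ G.IsInterval J := by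
  have key : ∀ x, ∀ y ∈ J, ((G.flip S).Arc x y ↔ G.Arc x y) ∧ ((G.flip S).Arc y x ↔ G.Arc y x) :=
    fun x y hy => ⟨flip_arc_of_not fun M hM _ => h M hM y hy,
      flip_arc_of_not fun M hM hyM => (h M hM y hy hyM).elim⟩
  simp only [isInterval_iff]
  refine forall₂_congr fun x hx => forall₂_congr fun y hy => forall₂_congr fun z hz => ?_
  rw [(key x y hy).1, (key x y hy).2, (key x z hz).1, (key x z hz).2]

/-- Dualizing pairwise disjoint intervals inducing diamond-free tournaments preserves the
subdigraphs on at most six vertices up to hemimorphy. -/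
theorem flip_leHemi {G : Dgraph V} {S : Set (Set V)}
    (hdisj : ∀ M ∈ S, ∀ N ∈ S, ∀ x ∈ M, x ∈ N → M = N)
    (hI : ∀ M ∈ S, G.IsInterval M) (hD : ∀ M ∈ S, G.DiamondFreeOn M) :
    LeHemi 6 G (G.flip S) := by
  intro j _ hj X hX hXj
  by_cases hsub : ∃ M ∈ S, X ⊆ M
  · obtain ⟨M, hM, hXM⟩ := hsub
    exact .inr ⟨Equiv.refl _, fun x y => (flip_arc_of_mem hM (hXM x.2) (hXM y.2)).symm⟩
  left
  let s : Setoid V :=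
    { r := fun x y => x = y ∨ ∃ M ∈ S, x ∈ M ∧ y ∈ M
      iseqv := by
        refine ⟨fun x => .inl rfl, fun {x y} h => ?_, fun {x y z} h h' => ?_⟩
        · rcases h with rfl | ⟨M, hM, hx, hy⟩
          · exact .inl rfl
          · exact .inr ⟨M, hM, hy, hx⟩
        · rcases h with rfl | ⟨M, hM, hx, hy⟩
          · exact h'
          · rcases h' with rfl | ⟨N, hN, hy', hz⟩
            · exact .inr ⟨M, hM, hx, hy⟩
            · obtain rfl := hdisj M hM N hN y hy hy'
              exact .inr ⟨M, hM, hx, hz⟩ }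
  have hs : ∀ x y, (Quotient.mk s x = Quotient.mk s y) ↔ (x = y ∨ ∃ M ∈ S, x ∈ M ∧ y ∈ M) :=
    fun x y => Quotient.eq
  refine iso_ind_of_fibers (Quotient.mk s) (fun x y hxy => ?_) (fun x y z hxy hyz => ?_) X
    fun q => ?_
  · rw [Ne, hs] at hxy
    exact (flip_arc_of_not fun M hM hx hy => hxy (.inr ⟨M, hM, hx, hy⟩)).symm
  · rw [hs] at hyz
    rcases hyz with rfl | ⟨M, hM, hy, hz⟩
    · exact ⟨Iff.rfl, Iff.rfl⟩
    · refine isInterval_iff.1 (hI M hM) x (fun hx => hxy ((hs _ _).2 (.inr ⟨M, hM, hx, hy⟩)))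
        y hy z hz
  · induction q using Quotient.inductionOn with | _ w
    by_cases hw : ∃ M ∈ S, w ∈ M
    · obtain ⟨M, hM, hwM⟩ := hw
      have hsubM : {x | x ∈ X ∧ Quotient.mk s x = Quotient.mk s w} ⊆ M := by
        rintro x ⟨-, hx⟩
        rcases (hs _ _).1 hx with rfl | ⟨N, hN, hxN, hwN⟩
        · exact hwM
        · exact hdisj M hM N hN w hwM hwN ▸ hxN
      have hssub : {x | x ∈ X ∧ Quotient.mk s x = Quotient.mk s w} ⊂ X := by
        refine ⟨fun x hx => hx.1, fun h => hsub ⟨M, hM, h.trans hsubM⟩⟩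
      have hlt := Set.ncard_lt_ncard hssub hX
      refine (((hD M hM).mono hsubM).selfDual_ind (hX.subset hssub.1) (by omega)).trans ?_
      exact ⟨Equiv.refl _, fun x y => (flip_arc_of_mem hM (hsubM x.2) (hsubM y.2)).symm⟩
    · refine iso_ind_of_forall fun x hx y hy => (flip_arc_of_not fun M hM hxM => ?_).symm
      rcases (hs _ _).1 hx.2 with rfl | ⟨N, hN, -, hwN⟩
      · exact (hw ⟨M, hM, hxM⟩).elim
      · exact (hw ⟨N, hN, hwN⟩).elim

end Flip

section UniqueInterval

variable {V : Type u} {W : Type v}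

theorem acRel_map {G : Dgraph V} {G' : Dgraph W} (e : V ≃ W)
    (he : ∀ x y, G.Arc x y ↔ G'.Arc (e x) (e y)) (x y : V) :
    G.ACRel x y ↔ G'.ACRel (e x) (e y) := by
  constructor
  · exact fun h => h.lift e fun a b hab => by simpa only [Dir, he] using hab
  · intro h
    have := Relation.ReflTransGen.lift (p := G.Dir) e.symm
      (fun a b hab => by simpa [Function.onFun, Dir, he] using hab) _ _ h
    change Relation.ReflTransGen G.Dir x y
    simpa only [Function.onFun, Equiv.symm_apply_apply] using this

theorem isACComponent_preimage {G : Dgraph V} {G' : Dgraph W} (e : V ≃ W)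
    (he : ∀ x y, G.Arc x y ↔ G'.Arc (e x) (e y)) {J : Set W}
    (h : G.IsACComponent (e ⁻¹' J)) : G'.IsACComponent J := by
  obtain ⟨x, hx⟩ := h
  refine ⟨e x, Set.ext fun y => ?_⟩
  have := Set.ext_iff.1 hx (e.symm y)
  simpa [acRel_map e he] using this

theorem isACComponent_congr {G G' : Dgraph V} (h : G.Dir = G'.Dir) (D : Set V) :
    G.IsACComponent D ↔ G'.IsACComponent D := by
  simp only [IsACComponent, ACRel, h]

theorem dual_dir (G : Dgraph V) : G.dual.Dir = G.Dir := by
  funext x y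
  exact propext or_comm

theorem L12Int.dual {G : Dgraph V} {I : Set V} (h : G.L12Int I) : G.dual.L12Int I :=
  ⟨h.1.dual, DiamondFreeTournament.dual h.2.1, fun h' => h.2.2.1 h'.dual,
    fun h' => h.2.2.2 ((isACComponent_congr G.dual_dir I).1 h')⟩

theorem L12Int.preimage {G : Dgraph V} {G' : Dgraph W} (e : V ≃ W)
    (he : ∀ x y, G.Arc x y ↔ G'.Arc (e x) (e y)) {J : Set W} (hJ : G'.L12Int J) :
    G.L12Int (e ⁻¹' J) := by
  have hiso := iso_ind_preimage e he J
  refine ⟨isInterval_preimage e he hJ.1, ?_, ?_, ?_⟩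
  · exact diamondFreeTournament_ind_iff.2
      ((diamondFreeTournament_ind_iff.1 hJ.2.1).preimage e he)
  · exact fun h => hJ.2.2.1 ((hiso.symm.trans h).trans hiso.dual)
  · exact fun h => hJ.2.2.2 (isACComponent_preimage e he h)

theorem not_halfRecon_of_condL2 {G : Dgraph V} (h : G.CondL2) : ¬ G.HalfRecon 6 := by
  obtain ⟨I, hI, huniq, hcontr⟩ := h
  have hdisj : ∀ M ∈ ({I} : Set (Set V)), ∀ N ∈ ({I} : Set (Set V)), ∀ x ∈ M, x ∈ N → M = N := by
    rintro M rfl N rfl _ _ _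
    rfl
  have hmem : I ∈ ({I} : Set (Set V)) := rfl
  have hflip : Iso (G.ind I).dual ((G.flip {I}).ind I) := flip_ind_of_mem hmem
  have hDI := diamondFreeTournament_ind_iff.1 hI.2.1
  have hL : (G.flip {I}).L12Int I := by
    refine ⟨flip_isInterval_of_mem hdisj hmem hI.1, ?_, fun h => ?_, fun h => ?_⟩
    · exact diamondFreeTournament_ind_iff.2
        (hDI.dual.congr fun x hx y hy => flip_arc_of_mem hmem hx hy)
    · exact hI.2.2.1 (((hflip.trans h).trans hflip.symm.dual).dual)
    · exact hI.2.2.2 ((isACComponent_congr (flip_dir _ _) I).1 h)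
  intro hG
  rcases hG (G.flip {I}) (flip_leHemi hdisj (by rintro M rfl; exact hI.1)
    (by rintro M rfl; exact hDI)) with ⟨e, he⟩ | ⟨e, he⟩
  · have hiso := iso_ind_preimage e he I
    rw [huniq _ (hL.preimage e he)] at hiso
    exact hI.2.2.1 (hiso.trans hflip.symm)
  · have heI : e ⁻¹' I = I := huniq _ (hL.preimage e he).dual
    have hmemI : ∀ x, e x ∈ I ↔ x ∈ I := fun x => Set.ext_iff.1 heI x
    have hout : ∀ x y, x ∉ I ∨ y ∉ I → (G.Arc x y ↔ G.Arc (e y) (e x)) := by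
      intro x y hxy
      refine (he y x).trans (flip_arc_of_not ?_)
      rintro M rfl h1 h2
      rw [hmemI] at h1 h2
      tauto
    refine hcontr ⟨Equiv.optionCongr (e.subtypeEquiv fun x => not_congr (hmemI x).symm), rfl, ?_⟩
    have hex : ∀ P : V → Prop, (∃ z ∈ I, P (e z)) ↔ ∃ z ∈ I, P z := by
      refine fun P => ⟨fun ⟨z, hz, h⟩ => ⟨e z, (hmemI z).2 hz, h⟩, fun ⟨z, hz, h⟩ =>
        ⟨e.symm z, (hmemI _).1 (by simpa using hz), by simpa using h⟩⟩
    rintro (_ | x) (_ | y)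
    · exact Iff.rfl
    · change (∃ z ∈ I, G.Arc z y.1) ↔ ∃ z ∈ I, G.Arc (e y.1) z
      rw [← hex fun z => G.Arc (e y.1) z]
      exact exists_congr fun z => and_congr_right fun _ => hout z y.1 (.inr y.2)
    · change (∃ z ∈ I, G.Arc x.1 z) ↔ ∃ z ∈ I, G.Arc z (e x.1)
      rw [← hex fun z => G.Arc z (e x.1)]
      exact exists_congr fun z => and_congr_right fun _ => hout x.1 z (.inl x.2)
    · exact hout x.1 y.1 (.inl x.2)

end UniqueInterval

section CyclicIntervals

variable {V : Type u} {W : Type v}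

/-- An interval inducing a diamond-free tournament which contains a 3-cycle. -/
def IsCyclicInterval (G : Dgraph V) (I : Set V) : Prop :=
  G.IsInterval I ∧ G.DiamondFreeOn I ∧
    ∃ a ∈ I, ∃ b ∈ I, ∃ c ∈ I, G.Arc a b ∧ G.Arc b c ∧ G.Arc c a

theorem IsCyclicInterval.dual {G : Dgraph V} {I : Set V} (h : G.IsCyclicInterval I) :
    G.dual.IsCyclicInterval I := by
  obtain ⟨hI, hD, a, ha, b, hb, c, hc, h1, h2, h3⟩ := h
  exact ⟨hI.dual, hD.dual, a, ha, c, hc, b, hb, h3, h2, h1⟩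

theorem IsCyclicInterval.preimage {G : Dgraph V} {G' : Dgraph W} (e : V ≃ W)
    (he : ∀ x y, G.Arc x y ↔ G'.Arc (e x) (e y)) {J : Set W} (hJ : G'.IsCyclicInterval J) :
    G.IsCyclicInterval (e ⁻¹' J) := by
  obtain ⟨hI, hD, a, ha, b, hb, c, hc, h1, h2, h3⟩ := hJ
  exact ⟨isInterval_preimage e he hI, hD.preimage e he, e.symm a, by simpa using ha,
    e.symm b, by simpa using hb, e.symm c, by simpa using hc, by simpa [he] using h1,
    by simpa [he] using h2, by simpa [he] using h3⟩

theorem IsCyclicInterval.not_arc_of_not_mem {G : Dgraph V} {I J : Set V}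
    (hI : G.IsCyclicInterval I) (hJ : G.IsInterval J) (hD : G.DiamondFreeOn J) {v z : V}
    (hzI : z ∈ I) (hzJ : z ∈ J) (hvI : v ∉ I) (hvJ : v ∈ J) : ¬ G.Arc v z := by
  intro hvz
  obtain ⟨hI, hDI, a, ha, b, hb, c, hc, hab, hbc, hca⟩ := hI
  rw [isInterval_iff] at hI hJ
  have hv : ∀ x ∈ I, G.Arc v x := fun x hx => (hI v hvI z hzI x hx).1.1 hvz
  have hout : ∀ x ∈ I, x ∉ J → ∀ y ∈ J, G.Arc y x :=
    fun x hx hxJ y hy => (hJ x hxJ v hvJ y hy).2.1 (hv x hx)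
  have hstep : ∀ x ∈ I, ∀ y ∈ I, G.Arc x y → x ∉ J → y ∉ J :=
    fun x hx y hy hxy hxJ hyJ => hDI.not_arc hx hy hxy (hout x hx hxJ y hyJ)
  by_cases haJ : a ∈ J
  · have hcJ : c ∈ J := by_contra fun h => hstep c hc a ha hca h haJ
    have hbJ : b ∈ J := by_contra fun h => hstep b hb c hc hbc h hcJ
    exact (hD.2 v hvJ a haJ b hbJ c hcJ hab hbc hca).1 ⟨hv a ha, hv b hb, hv c hc⟩
  · have hbJ := hstep a ha b hb hab haJ
    have hcJ := hstep b hb c hc hbc hbJ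
    exact (hDI.2 z hzI a ha b hb c hc hab hbc hca).1
      ⟨hout a ha haJ z hzJ, hout b hb hbJ z hzJ, hout c hc hcJ z hzJ⟩

theorem IsCyclicInterval.subset_of_mem {G : Dgraph V} {I J : Set V} (hI : G.IsCyclicInterval I)
    (hJ : G.IsInterval J) (hD : G.DiamondFreeOn J) {z : V} (hzI : z ∈ I) (hzJ : z ∈ J) :
    J ⊆ I := by
  intro v hv
  by_contra hvI
  rcases hD.1 v hv z hzJ (by rintro rfl; exact hvI hzI) with h | h
  · exact hI.not_arc_of_not_mem hJ hD hzI hzJ hvI hv h.1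
  · exact hI.dual.not_arc_of_not_mem hJ.dual hD.dual hzI hzJ hvI hv h.1

theorem IsCyclicInterval.eq_of_mem {G : Dgraph V} {I J : Set V} (hI : G.IsCyclicInterval I)
    (hJ : G.IsCyclicInterval J) {z : V} (hzI : z ∈ I) (hzJ : z ∈ J) : I = J :=
  (hJ.subset_of_mem hI.1 hI.2.1 hzJ hzI).antisymm (hI.subset_of_mem hJ.1 hJ.2.1 hzI hzJ)

theorem cyclicIntervals_disjoint {G : Dgraph V} {S : Set (Set V)}
    (hS : ∀ M ∈ S, G.IsCyclicInterval M) :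
    ∀ M ∈ S, ∀ N ∈ S, ∀ x ∈ M, x ∈ N → M = N :=
  fun M hM N hN _ hx hx' => (hS M hM).eq_of_mem (hS N hN) hx hx'

theorem flip_isCyclicInterval_of_mem {G : Dgraph V} {S : Set (Set V)}
    (hS : ∀ M ∈ S, G.IsCyclicInterval M) {M : Set V} (hM : M ∈ S) :
    (G.flip S).IsCyclicInterval M := by
  obtain ⟨hI, hD, a, ha, b, hb, c, hc, h1, h2, h3⟩ := hS M hM
  refine ⟨flip_isInterval_of_mem (cyclicIntervals_disjoint hS) hM hI,
    hD.dual.congr fun x hx y hy => flip_arc_of_mem hM hx hy, a, ha, c, hc, b, hb, ?_, ?_, ?_⟩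
  · rwa [flip_arc_of_mem hM ha hc]
  · rwa [flip_arc_of_mem hM hc hb]
  · rwa [flip_arc_of_mem hM hb ha]

theorem flip_isCyclicInterval {G : Dgraph V} {S : Set (Set V)}
    (hS : ∀ M ∈ S, G.IsCyclicInterval M) {J : Set V} :
    (G.flip S).IsCyclicInterval J ↔ G.IsCyclicInterval J := by
  by_cases hJS : J ∈ S
  · exact iff_of_true (flip_isCyclicInterval_of_mem hS hJS) (hS J hJS)
  have key : (∀ M ∈ S, ∀ x ∈ J, x ∉ M) →
      ((G.flip S).IsCyclicInterval J ↔ G.IsCyclicInterval J) := by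
    intro h
    have harc : ∀ x ∈ J, ∀ y ∈ J, (G.flip S).Arc x y ↔ G.Arc x y :=
      fun x hx y _ => flip_arc_of_not fun M hM hxM => (h M hM x hx hxM).elim
    refine and_congr (flip_isInterval_of_disjoint h) (and_congr ?_ ?_)
    · exact ⟨fun hD => hD.congr fun x hx y hy => (harc x hx y hy).symm, fun hD => hD.congr harc⟩
    · refine exists_congr fun a => and_congr_right fun ha => exists_congr fun b =>
        and_congr_right fun hb => exists_congr fun c => and_congr_right fun hc => ?_
      rw [harc a ha b hb, harc b hb c hc, harc c hc a ha]
  constructor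
  · intro h
    refine (key fun M hM x hx hxM => hJS ?_).1 h
    exact h.eq_of_mem (flip_isCyclicInterval_of_mem hS hM) hx hxM ▸ hM
  · intro h
    refine (key fun M hM x hx hxM => hJS ?_).2 h
    exact h.eq_of_mem (hS M hM) hx hxM ▸ hM

theorem flip_ind_of_not_mem {G : Dgraph V} {S : Set (Set V)}
    (hS : ∀ M ∈ S, G.IsCyclicInterval M) {J : Set V} (hJ : G.IsCyclicInterval J) (hJS : J ∉ S) :
    Iso (G.ind J) ((G.flip S).ind J) :=
  flip_ind_of_disjoint fun M hM _ hx hxM => hJS (hJ.eq_of_mem (hS M hM) hx hxM ▸ hM)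

theorem not_halfRecon_of_cyclicIntervals {G : Dgraph V} {I J : Set V} (hIJ : I ≠ J)
    (hI : G.IsCyclicInterval I) (hJ : G.IsCyclicInterval J) (hIn : ¬ SelfDual (G.ind I))
    (hJn : ¬ SelfDual (G.ind J)) : ¬ G.HalfRecon 6 := by
  let S : Set (Set V) := {M | G.IsCyclicInterval M ∧ (Iso (G.ind M) (G.ind I).dual ∨
    (Iso (G.ind M) (G.ind J).dual ∧ ¬ Hemi (G.ind I) (G.ind J)))}
  have hS : ∀ M ∈ S, G.IsCyclicInterval M := fun M hM => hM.1
  have hT : ∀ M ∈ insert I S, G.IsCyclicInterval M := by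
    rintro M (rfl | hM)
    · exact hI
    · exact hS M hM
  have hIS : I ∉ S := by
    rintro ⟨-, h | ⟨h, h'⟩⟩
    · exact hIn h
    · exact h' (.inr h.dual)
  have hleS := flip_leHemi (cyclicIntervals_disjoint hS) (fun M hM => (hS M hM).1)
    fun M hM => (hS M hM).2.1
  have hleT := flip_leHemi (cyclicIntervals_disjoint hT) (fun M hM => (hT M hM).1)
    fun M hM => (hT M hM).2.1
  have hfI : ∀ M, G.IsCyclicInterval M → ¬ Iso ((G.flip S).ind M) (G.ind I).dual := by
    intro M hM h
    by_cases hMS : M ∈ S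
    · have h1 : Iso (G.ind M) (G.ind I) := ((flip_ind_of_mem hMS).trans h).dual
      rcases hMS.2 with h2 | ⟨h2, h3⟩
      · exact hIn (h1.symm.trans h2)
      · exact h3 (.inr (h1.symm.trans h2).dual)
    · exact hMS ⟨hM, .inl ((flip_ind_of_not_mem hS hM hMS).trans h)⟩
  have hfJ : ∀ M, G.IsCyclicInterval M →
      ¬ Iso ((G.flip S).ind M) ((G.flip S).ind J).dual := by
    intro M hM h
    by_cases hH : Hemi (G.ind I) (G.ind J)
    · suffices hJI : Iso ((G.flip S).ind J) (G.ind I) from hfI M hM (h.trans hJI.dual)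
      by_cases hJS : J ∈ S
      · rcases hJS.2 with h2 | ⟨h2, h3⟩
        · exact (flip_ind_of_mem hJS).symm.trans h2.dual
        · exact (h3 hH).elim
      · rcases hH with h2 | h2
        · exact (flip_ind_of_not_mem hS hJ hJS).symm.trans h2.symm
        · exact (hJS ⟨hJ, .inl h2.symm⟩).elim
    · have hJS : J ∉ S := by
        rintro ⟨-, h2 | ⟨h2, -⟩⟩
        · exact hH (.inr h2.symm)
        · exact hJn h2
      have h' := h.trans (flip_ind_of_not_mem hS hJ hJS).symm.dual
      by_cases hMS : M ∈ S
      · have h1 : Iso (G.ind M) (G.ind J) := ((flip_ind_of_mem hMS).trans h').dual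
        rcases hMS.2 with h2 | ⟨h2, -⟩
        · exact hH (.inr (h2.symm.trans h1))
        · exact hJn (h1.symm.trans h2)
      · exact hMS ⟨hM, .inr ⟨(flip_ind_of_not_mem hS hM hMS).trans h', hH⟩⟩
  have hIT : Iso ((G.flip (insert I S)).ind I) (G.ind I).dual :=
    (flip_ind_of_mem (Set.mem_insert I S)).symm
  have hJT : Iso ((G.flip (insert I S)).ind J) ((G.flip S).ind J) := by
    by_cases hJS : J ∈ S
    · exact (flip_ind_of_mem (Set.mem_insert_of_mem I hJS)).symm.trans (flip_ind_of_mem hJS)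
    · exact (flip_ind_of_not_mem hT hJ (by simp [hIJ.symm, hJS])).symm.trans
        (flip_ind_of_not_mem hS hJ hJS)
  refine not_halfRecon_of_not_hemi hleS hleT ?_
  rintro (⟨e, he⟩ | ⟨e, he⟩)
  · refine hfI (e ⁻¹' I) ?_ ((iso_ind_preimage e he I).trans hIT)
    exact (flip_isCyclicInterval hS).1 (((flip_isCyclicInterval hT).2 hI).preimage e he)
  · refine hfJ (e ⁻¹' J) ?_ ((iso_ind_preimage e he J).trans hJT).dual
    exact (flip_isCyclicInterval hS).1 (((flip_isCyclicInterval hT).2 hJ).preimage e he).dual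

end CyclicIntervals

section ChainIntervals

variable {V : Type u} {W : Type v}

/-- `I` induces a chain, spelled out on vertices. -/
def ChainOn (G : Dgraph V) (I : Set V) : Prop :=
  (∀ x ∈ I, ∀ y ∈ I, x ≠ y → G.Dir x y) ∧
  ∀ x ∈ I, ∀ y ∈ I, ∀ z ∈ I, G.Arc x y → G.Arc y z → G.Arc x z

theorem isChainD_ind_iff {G : Dgraph V} {I : Set V} :
    (G.ind I).IsChainD ↔ G.ChainOn I := by
  refine and_congr ⟨fun h x hx y hy hxy => h ⟨x, hx⟩ ⟨y, hy⟩ (by simpa using hxy),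
    fun h x y hxy => h x x.2 y y.2 fun h' => hxy (Subtype.ext h')⟩
    ⟨fun h x hx y hy z hz => h ⟨x, hx⟩ ⟨y, hy⟩ ⟨z, hz⟩,
      fun h x y z => h x x.2 y y.2 z z.2⟩

theorem ChainOn.mono {G : Dgraph V} {I J : Set V} (h : G.ChainOn I) (hJ : J ⊆ I) :
    G.ChainOn J :=
  ⟨fun x hx y hy => h.1 x (hJ hx) y (hJ hy),
    fun x hx y hy z hz => h.2 x (hJ hx) y (hJ hy) z (hJ hz)⟩

theorem IsChainD.dual {G : Dgraph V} (h : G.IsChainD) : G.dual.IsChainD :=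
  ⟨fun x y hxy => h.1 y x hxy.symm, fun x y z h1 h2 => h.2 z y x h2 h1⟩

theorem IsChainD.iso_fin {G : Dgraph V} [Finite V] (h : G.IsChainD) :
    Iso G (ofRel fun i j : Fin (Nat.card V) => i < j) := by
  classical
  have := Fintype.ofFinite V
  have : IsStrictTotalOrder V G.Arc :=
    { irrefl := G.irrefl
      trans := h.2
      trichotomous := fun x y h1 h2 => by
        by_contra hne
        rcases h.1 x y hne with h' | h' <;> tauto }
  let _ := linearOrderOfSTO G.Arc
  let e := Fintype.orderIsoFinOfCardEq V (Nat.card_eq_fintype_card (α := V)).symm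
  refine ⟨e.symm.toEquiv, fun x y => ?_⟩
  change x < y ↔ e.symm x ≠ e.symm y ∧ e.symm x < e.symm y
  rw [e.symm.lt_iff_lt]
  exact ⟨fun h => ⟨fun h' => h.ne (e.symm.injective h'), h⟩, And.right⟩

theorem IsChainD.iso {G G' : Dgraph V} [Finite V] (h : G.IsChainD) (h' : G'.IsChainD) :
    Iso G G' :=
  h.iso_fin.trans h'.iso_fin.symm

/-- An interval inducing a chain. -/
def IsChainInterval (G : Dgraph V) (I : Set V) : Prop := G.IsInterval I ∧ G.ChainOn I

theorem IsChainInterval.dual {G : Dgraph V} {I : Set V} (h : G.IsChainInterval I) :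
    G.dual.IsChainInterval I :=
  ⟨h.1.dual, fun x hx y hy hxy => h.2.1 y hy x hx hxy.symm,
    fun x hx y hy z hz h1 h2 => h.2.2 z hz y hy x hx h2 h1⟩

theorem IsChainInterval.preimage {G : Dgraph V} {G' : Dgraph W} (e : V ≃ W)
    (he : ∀ x y, G.Arc x y ↔ G'.Arc (e x) (e y)) {J : Set W} (hJ : G'.IsChainInterval J) :
    G.IsChainInterval (e ⁻¹' J) := by
  refine ⟨isInterval_preimage e he hJ.1, fun x hx y hy hxy => ?_, fun x hx y hy z hz => ?_⟩
  · simpa only [Dir, he] using hJ.2.1 (e x) hx (e y) hy (e.injective.ne hxy)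
  · simpa only [he] using hJ.2.2 _ hx _ hy _ hz

theorem IsChainInterval.union {G : Dgraph V} {I J : Set V} (hI : G.IsChainInterval I)
    (hJ : G.IsChainInterval J) {w : V} (hwI : w ∈ I) (hwJ : w ∈ J) :
    G.IsChainInterval (I ∪ J) := by
  obtain ⟨hI, hCI, hTI⟩ := hI
  obtain ⟨hJ, hCJ, hTJ⟩ := hJ
  rw [isInterval_iff] at hI hJ
  have hdir : ∀ x ∈ I ∪ J, ∀ y ∈ I ∪ J, x ≠ y → G.Dir x y := by
    have key : ∀ x ∈ I, ∀ y ∈ J, x ≠ y → G.Dir x y := by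
      intro x hx y hy hxy
      by_cases hxJ : x ∈ J
      · exact hCJ x hxJ y hy hxy
      · have h1 := hCI x hx w hwI (by rintro rfl; exact hxJ hwJ)
        have h2 := hJ x hxJ w hwJ y hy
        rwa [Dir, h2.1, h2.2] at h1
    rintro x (hx | hx) y (hy | hy) hxy
    · exact hCI x hx y hy hxy
    · exact key x hx y hy hxy
    · exact (key y hy x hx hxy.symm).symm
    · exact hCJ x hx y hy hxy
  have htwo : ∀ K : Set V, (∀ x ∉ K, ∀ y ∈ K, ∀ z ∈ K,
      (G.Arc x y ↔ G.Arc x z) ∧ (G.Arc y x ↔ G.Arc z x)) →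
      (∀ x ∈ K, ∀ y ∈ K, ∀ z ∈ K, G.Arc x y → G.Arc y z → G.Arc x z) →
      ∀ x ∈ I ∪ J, ∀ y ∈ I ∪ J, ∀ z ∈ I ∪ J, G.Arc x y → G.Arc y z →
      (x ∈ K ∧ y ∈ K ∨ y ∈ K ∧ z ∈ K ∨ x ∈ K ∧ z ∈ K) → G.Arc x z := by
    intro K hK hT x hx y hy z hz hxy hyz h
    by_cases hxK : x ∈ K <;> by_cases hyK : y ∈ K <;> by_cases hzK : z ∈ K <;>
      simp only [hxK, hyK, hzK, and_self, and_false, false_and, or_self] at h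
    · exact hT x hxK y hyK z hzK hxy hyz
    · exact (hK z hzK x hxK y hyK).2.2 hyz
    · have h1 := (hK y hyK x hxK z hzK).2.1 hxy
      have hne : y ≠ z := by rintro rfl; exact G.irrefl _ hyz
      rcases hdir y hy z hz hne with h2 | h2 <;> tauto
    · exact (hK x hxK y hyK z hzK).1.1 hxy
  refine ⟨isInterval_iff.2 ?_, hdir, fun x hx y hy z hz hxy hyz => ?_⟩
  · intro x hx y hy z hz
    rw [Set.mem_union, not_or] at hx
    have key : ∀ y ∈ I ∪ J, (G.Arc x w ↔ G.Arc x y) ∧ (G.Arc w x ↔ G.Arc y x) := by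
      rintro y (hy | hy)
      · exact hI x hx.1 w hwI y hy
      · exact hJ x hx.2 w hwJ y hy
    have h1 := key y hy
    have h2 := key z hz
    tauto
  · have h1 := htwo I hI hTI x hx y hy z hz hxy hyz
    have h2 := htwo J hJ hTJ x hx y hy z hz hxy hyz
    simp only [Set.mem_union] at hx hy hz
    tauto

theorem isChainInterval_singleton (G : Dgraph V) (x : V) : G.IsChainInterval {x} := by
  refine ⟨isInterval_iff.2 ?_, ?_, ?_⟩
  · rintro y - _ rfl _ rfl
    exact ⟨Iff.rfl, Iff.rfl⟩
  · rintro _ rfl _ rfl h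
    exact (h rfl).elim
  · rintro _ rfl _ rfl _ rfl h _
    exact h

/-- Two vertices are related when some interval inducing a chain contains both. -/
def chainSetoid (G : Dgraph V) : Setoid V where
  r x y := ∃ J, G.IsChainInterval J ∧ x ∈ J ∧ y ∈ J
  iseqv :=
    ⟨fun x => ⟨{x}, G.isChainInterval_singleton x, rfl, rfl⟩,
      fun ⟨J, hJ, hx, hy⟩ => ⟨J, hJ, hy, hx⟩,
      fun ⟨J, hJ, hx, hy⟩ ⟨K, hK, hy', hz⟩ => ⟨J ∪ K, hJ.union hK hy hy', .inl hx, .inr hz⟩⟩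

theorem chainSetoid_uniform {G : Dgraph V} {x y z : V} (hxy : ¬ G.chainSetoid x y)
    (hyz : G.chainSetoid y z) : (G.Arc x y ↔ G.Arc x z) ∧ (G.Arc y x ↔ G.Arc z x) := by
  obtain ⟨J, hJ, hy, hz⟩ := hyz
  exact isInterval_iff.1 hJ.1 x (fun hx => hxy ⟨J, hJ, hx, hy⟩) y hy z hz

theorem chainSetoid_dir {G : Dgraph V} {x y : V} (h : G.chainSetoid x y) (hne : x ≠ y) :
    G.Dir x y := by
  obtain ⟨J, hJ, hx, hy⟩ := h
  exact hJ.2.1 x hx y hy hne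

theorem chainSetoid_trans_arc {G : Dgraph V} {x y z : V} (h : G.chainSetoid x y)
    (h' : G.chainSetoid y z) (hxy : G.Arc x y) (hyz : G.Arc y z) : G.Arc x z := by
  obtain ⟨J, hJ, hx, hy⟩ := h
  obtain ⟨K, hK, hy', hz⟩ := h'
  exact (hJ.union hK hy hy').2.2 x (.inl hx) y (.inl hy) z (.inr hz) hxy hyz

theorem chainSetoid_preimage {G : Dgraph V} {G' : Dgraph W} (e : V ≃ W)
    (he : ∀ x y, G.Arc x y ↔ G'.Arc (e x) (e y)) (x y : V) :
    G.chainSetoid x y ↔ G'.chainSetoid (e x) (e y) := by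
  constructor
  · rintro ⟨J, hJ, hx, hy⟩
    have he' : ∀ x y, G'.Arc x y ↔ G.Arc (e.symm x) (e.symm y) := fun x y => by simp [he]
    exact ⟨e.symm ⁻¹' J, hJ.preimage e.symm he', by simpa using hx, by simpa using hy⟩
  · rintro ⟨J, hJ, hx, hy⟩
    exact ⟨e ⁻¹' J, hJ.preimage e he, hx, hy⟩

theorem chainSetoid_dual (G : Dgraph V) (x y : V) :
    G.dual.chainSetoid x y ↔ G.chainSetoid x y :=
  ⟨fun ⟨J, hJ, h⟩ => ⟨J, hJ.dual, h⟩, fun ⟨J, hJ, h⟩ => ⟨J, hJ.dual, h⟩⟩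

/-- The digraph obtained from `G` by reordering every class `M` of `G.chainSetoid` by `r M`. -/
def reorder (G : Dgraph V) (r : Set V → V → V → Prop) (hr : ∀ M x, ¬ r M x x) : Dgraph V :=
  ⟨fun x y => (G.chainSetoid x y ∧ r {z | G.chainSetoid x z} x y) ∨
    (¬ G.chainSetoid x y ∧ G.Arc x y), fun x h => by
      rcases h with h | h
      · exact hr _ _ h.2
      · exact G.irrefl x h.2⟩

section Reorder

variable {G : Dgraph V} {r : Set V → V → V → Prop} {hr : ∀ M x, ¬ r M x x}

theorem reorder_arc_of_not {x y : V} (h : ¬ G.chainSetoid x y) :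
    (G.reorder r hr).Arc x y ↔ G.Arc x y := by
  simp only [reorder]
  tauto

theorem setOf_chainSetoid_eq {x y : V} (h : G.chainSetoid x y) :
    {z | G.chainSetoid x z} = {z | G.chainSetoid y z} :=
  Set.ext fun _ => ⟨fun h' => G.chainSetoid.trans (G.chainSetoid.symm h) h',
    fun h' => G.chainSetoid.trans h h'⟩

theorem reorder_arc_of_mem {w x y : V} (hx : G.chainSetoid w x) (hy : G.chainSetoid w y) :
    (G.reorder r hr).Arc x y ↔ r {z | G.chainSetoid w z} x y := by
  have h : G.chainSetoid x y := G.chainSetoid.trans (G.chainSetoid.symm hx) hy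
  rw [setOf_chainSetoid_eq hx]
  simp only [reorder]
  tauto

theorem reorder_chainOn
    (hT : ∀ M, ∀ x ∈ M, ∀ y ∈ M, ∀ z ∈ M, r M x y → r M y z → r M x z)
    (hC : ∀ M, ∀ x ∈ M, ∀ y ∈ M, x ≠ y → r M x y ∨ r M y x) (w : V) :
    (G.reorder r hr).ChainOn {z | G.chainSetoid w z} := by
  refine ⟨fun x hx y hy hxy => ?_, fun x hx y hy z hz h1 h2 => ?_⟩
  · rw [Dir, reorder_arc_of_mem hx hy, reorder_arc_of_mem hy hx]
    have h1 := hC _ x hx y hy hxy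
    have h2 := hT _ x hx y hy x hx
    have h3 := hr {z | G.chainSetoid w z} x
    tauto
  · rw [reorder_arc_of_mem hx hy] at h1
    rw [reorder_arc_of_mem hy hz] at h2
    rw [reorder_arc_of_mem hx hz]
    exact hT _ x hx y hy z hz h1 h2

theorem reorder_leHemi
    (hT : ∀ M, ∀ x ∈ M, ∀ y ∈ M, ∀ z ∈ M, r M x y → r M y z → r M x z)
    (hC : ∀ M, ∀ x ∈ M, ∀ y ∈ M, x ≠ y → r M x y ∨ r M y x) (k : ℕ) : LeHemi k G (G.reorder r hr) := by
  intro j _ _ X hX _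
  left
  refine iso_ind_of_fibers (Quotient.mk G.chainSetoid) (fun x y hxy => ?_)
    (fun x y z hxy hyz => ?_) X fun q => ?_
  · rw [Ne, Quotient.eq] at hxy
    exact (reorder_arc_of_not hxy).symm
  · rw [Ne, Quotient.eq] at hxy
    exact chainSetoid_uniform hxy (Quotient.eq.1 hyz)
  · induction q using Quotient.inductionOn with | _ w
    have hsub : ∀ x ∈ {x | x ∈ X ∧ Quotient.mk G.chainSetoid x = Quotient.mk _ w},
        G.chainSetoid w x := fun x hx => G.chainSetoid.symm (Quotient.eq.1 hx.2)
    have := (hX.subset (t := {x | x ∈ X ∧ Quotient.mk G.chainSetoid x = Quotient.mk _ w})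
      fun x hx => hx.1).to_subtype
    refine IsChainD.iso (isChainD_ind_iff.2 ?_)
      (isChainD_ind_iff.2 ((reorder_chainOn hT hC w).mono hsub))
    have hxy : ∀ x ∈ {z | G.chainSetoid w z}, ∀ y ∈ {z | G.chainSetoid w z},
        G.chainSetoid x y := fun x hx y hy => G.chainSetoid.trans (G.chainSetoid.symm hx) hy
    exact ChainOn.mono ⟨fun x hx y hy hne => chainSetoid_dir (hxy x hx y hy) hne,
      fun x hx y hy z hz => chainSetoid_trans_arc (hxy x hx y hy) (hxy y hy z hz)⟩ hsub

theorem reorder_chainSetoid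
    (hT : ∀ M, ∀ x ∈ M, ∀ y ∈ M, ∀ z ∈ M, r M x y → r M y z → r M x z)
    (hC : ∀ M, ∀ x ∈ M, ∀ y ∈ M, x ≠ y → r M x y ∨ r M y x) (x y : V) :
    (G.reorder r hr).chainSetoid x y ↔ G.chainSetoid x y := by
  constructor
  · rintro ⟨J, ⟨hJ, hCJ⟩, hx, hy⟩
    have hJ := isInterval_iff.1 hJ
    have hrep : ∀ a a' b b', G.chainSetoid a a' → G.chainSetoid b b' → ¬ G.chainSetoid a b →
        (G.Arc a b ↔ (G.reorder r hr).Arc a' b') := by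
      intro a a' b b' ha hb hab
      have hab' : ¬ G.chainSetoid a b' :=
        fun h => hab (G.chainSetoid.trans h (G.chainSetoid.symm hb))
      have hab'' : ¬ G.chainSetoid a' b' := fun h => hab' (G.chainSetoid.trans ha h)
      rw [reorder_arc_of_not hab'', (chainSetoid_uniform hab hb).1]
      exact (chainSetoid_uniform (fun h => hab' (G.chainSetoid.symm h)) ha).2
    have hdir : ∀ a a' b b', a' ∈ J → b' ∈ J → G.chainSetoid a a' → G.chainSetoid b b' →
        a ≠ b → G.Dir a b := by
      intro a a' b b' ha' hb' ha hb hne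
      by_cases hab : G.chainSetoid a b
      · exact chainSetoid_dir hab hne
      · have hne' : a' ≠ b' := by
          rintro rfl
          exact hab (G.chainSetoid.trans ha (G.chainSetoid.symm hb))
        have := hCJ.1 a' ha' b' hb' hne'
        rwa [Dir, ← hrep a a' b b' ha hb hab,
          ← hrep b b' a a' hb ha fun h => hab (G.chainSetoid.symm h)] at this
    refine ⟨{v | ∃ z ∈ J, G.chainSetoid v z}, ⟨isInterval_iff.2 ?_, ?_, ?_⟩,
      ⟨x, hx, G.chainSetoid.refl x⟩, ⟨y, hy, G.chainSetoid.refl y⟩⟩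
    · rintro w hw a ⟨a', ha', ha⟩ b ⟨b', hb', hb⟩
      have hwJ : w ∉ J := fun h => hw ⟨w, h, G.chainSetoid.refl w⟩
      have key : ∀ c c', c' ∈ J → G.chainSetoid c c' → ¬ G.chainSetoid w c :=
        fun c c' hc' hc h => hw ⟨c', hc', G.chainSetoid.trans h hc⟩
      have hwa := key a a' ha' ha
      have hwb := key b b' hb' hb
      rw [hrep w w a a' (G.chainSetoid.refl w) ha hwa, hrep w w b b' (G.chainSetoid.refl w) hb hwb,
        hrep a a' w w ha (G.chainSetoid.refl w) fun h => hwa (G.chainSetoid.symm h),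
        hrep b b' w w hb (G.chainSetoid.refl w) fun h => hwb (G.chainSetoid.symm h)]
      exact hJ w hwJ a' ha' b' hb'
    · rintro a ⟨a', ha', ha⟩ b ⟨b', hb', hb⟩ hne
      exact hdir a a' b b' ha' hb' ha hb hne
    · rintro a ⟨a', ha', ha⟩ b ⟨b', hb', hb⟩ c ⟨c', hc', hc⟩ h1 h2
      by_cases hab : G.chainSetoid a b
      · by_cases hbc : G.chainSetoid b c
        · exact chainSetoid_trans_arc hab hbc h1 h2
        · exact (chainSetoid_uniform (fun h => hbc (G.chainSetoid.trans
            (G.chainSetoid.symm hab) (G.chainSetoid.symm h))) hab).2.2 h2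
      · by_cases hbc : G.chainSetoid b c
        · exact (chainSetoid_uniform hab hbc).1.1 h1
        · by_cases hac : G.chainSetoid a c
          · have h3 := (chainSetoid_uniform (fun h => hab (G.chainSetoid.symm h)) hac).1.2 h2
            have hne : a ≠ b := by rintro rfl; exact G.irrefl _ h1
            rcases hdir a a' b b' ha' hb' ha hb hne with h4 | h4 <;> tauto
          · rw [hrep a a' c c' ha hc hac]
            exact hCJ.2 a' ha' b' hb' c' hc' ((hrep a a' b b' ha hb hab).1 h1)
              ((hrep b b' c c' hb hc hbc).1 h2)
  · intro h
    refine ⟨{z | G.chainSetoid x z}, ⟨isInterval_iff.2 fun w hw a ha b hb => ?_,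
      reorder_chainOn hT hC x⟩, G.chainSetoid.refl x, h⟩
    have key : ∀ c, G.chainSetoid x c → ¬ G.chainSetoid w c :=
      fun c hc h => hw (G.chainSetoid.trans hc (G.chainSetoid.symm h))
    rw [reorder_arc_of_not (key a ha), reorder_arc_of_not (key b hb),
      reorder_arc_of_not fun h => key a ha (G.chainSetoid.symm h),
      reorder_arc_of_not fun h => key b hb (G.chainSetoid.symm h)]
    exact chainSetoid_uniform (key a ha) (G.chainSetoid.trans (G.chainSetoid.symm ha) hb)

end Reorder

theorem exists_linearOrder_forall_exists_lt (α : Type u) [Infinite α] :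
    ∃ _ : LinearOrder α, ∀ a : α, ∃ b, a < b := by
  have hcard : Cardinal.mk α = Cardinal.mk (α × ℕ) := by
    simp [Cardinal.mul_aleph0_eq (Cardinal.aleph0_le_mk α)]
  obtain ⟨e⟩ := Cardinal.eq.1 hcard
  obtain ⟨_, -⟩ := exists_wellFoundedLT α
  let f : α → α ×ₗ ℕ := fun a => toLex (e a)
  have hf : f.Injective := toLex.injective.comp e.injective
  refine ⟨LinearOrder.lift' f hf, fun a => ⟨e.symm ((e a).1, (e a).2 + 1), ?_⟩⟩
  change toLex (e a) < toLex (e (e.symm ((e a).1, (e a).2 + 1)))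
  rw [Equiv.apply_symm_apply, Prod.Lex.toLex_lt_toLex]
  exact .inr ⟨rfl, Nat.lt_succ_self _⟩

theorem exists_linearOrder_min_max (α : Type u) [Infinite α] :
    ∃ _ : LinearOrder α, (∃ a : α, ∀ b, a ≤ b) ∧ ∃ a : α, ∀ b, b ≤ a := by
  have hcard : Cardinal.mk α = Cardinal.mk (WithBot (WithTop α)) := by
    change _ = Cardinal.mk (Option (Option α))
    have := Cardinal.aleph0_le_mk α
    simp [Cardinal.add_one_eq this]
  obtain ⟨e⟩ := Cardinal.eq.1 hcard
  obtain ⟨_, -⟩ := exists_wellFoundedLT α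
  refine ⟨LinearOrder.lift' e e.injective, ⟨e.symm ⊥, fun b => ?_⟩, ⟨e.symm ⊤, fun b => ?_⟩⟩
  · change e (e.symm ⊥) ≤ e b
    simp
  · change e b ≤ e (e.symm ⊤)
    simp

/-- A strict linear order on `M`, as a relation on the ambient type, inherited from a linear order
on the subtype. -/
theorem exists_strictOrder_on (M : Set V) (P : (M → M → Prop) → Prop)
    (h : ∃ _ : LinearOrder M, P (· < ·)) :
    ∃ r : V → V → Prop, (∀ x, ¬ r x x) ∧ (∀ x ∈ M, ∀ y ∈ M, ∀ z ∈ M, r x y → r y z → r x z) ∧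
      (∀ x ∈ M, ∀ y ∈ M, x ≠ y → r x y ∨ r y x) ∧ P fun x y => r x y := by
  obtain ⟨_, hP⟩ := h
  refine ⟨fun x y => ∃ (hx : x ∈ M) (hy : y ∈ M), (⟨x, hx⟩ : M) < ⟨y, hy⟩, ?_, ?_, ?_, ?_⟩
  · rintro x ⟨hx, _, h⟩
    exact lt_irrefl _ h
  · rintro x hx y hy z hz ⟨_, _, h⟩ ⟨_, _, h'⟩
    exact ⟨hx, hz, h.trans h'⟩
  · intro x hx y hy hxy
    rcases lt_or_gt_of_ne (show (⟨x, hx⟩ : M) ≠ ⟨y, hy⟩ by simpa using hxy) with h | h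
    · exact .inl ⟨hx, hy, h⟩
    · exact .inr ⟨hy, hx, h⟩
  · convert hP using 3
    simp

theorem exists_reordering (P : ∀ M : Set V, (M → M → Prop) → Prop)
    (h : ∀ M : Set V, M.Infinite → ∃ _ : LinearOrder M, P M (· < ·)) :
    ∃ r : Set V → V → V → Prop, (∀ M x, ¬ r M x x) ∧
      (∀ M, ∀ x ∈ M, ∀ y ∈ M, ∀ z ∈ M, r M x y → r M y z → r M x z) ∧
      (∀ M, ∀ x ∈ M, ∀ y ∈ M, x ≠ y → r M x y ∨ r M y x) ∧
      ∀ M, M.Infinite → P M fun x y => r M x y := by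
  have : ∀ M : Set V, ∃ r : V → V → Prop, (∀ x, ¬ r x x) ∧
      (∀ x ∈ M, ∀ y ∈ M, ∀ z ∈ M, r x y → r y z → r x z) ∧
      (∀ x ∈ M, ∀ y ∈ M, x ≠ y → r x y ∨ r y x) ∧ (M.Infinite → P M fun x y => r x y) := by
    intro M
    refine exists_strictOrder_on M (fun s => M.Infinite → P M s) ?_
    by_cases hM : M.Infinite
    · obtain ⟨o, ho⟩ := h M hM
      exact ⟨o, fun _ => ho⟩
    · obtain ⟨o, -⟩ := exists_wellFoundedLT M
      exact ⟨o, fun h' => (hM h').elim⟩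
  choose r h1 h2 h3 h4 using this
  exact ⟨r, h1, h2, h3, h4⟩

theorem not_halfRecon_of_infinite_chainInterval {G : Dgraph V} {I : Set V}
    (hI : G.IsChainInterval I) (hinf : I.Infinite) (k : ℕ) : ¬ G.HalfRecon k := by
  obtain ⟨r, hr, hrT, hrC, hrP⟩ := exists_reordering (V := V) (fun M s => ∀ x, ∃ y, s x y) (by
    intro M hM
    have := hM.to_subtype
    exact exists_linearOrder_forall_exists_lt M)
  obtain ⟨s, hs, hsT, hsC, hsP⟩ := exists_reordering (V := V)
    (fun M s => (∃ x, ∀ y, ¬ s y x) ∧ ∃ x, ∀ y, ¬ s x y) (by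
    intro M hM
    have := hM.to_subtype
    obtain ⟨o, ⟨a, ha⟩, ⟨b, hb⟩⟩ := exists_linearOrder_min_max M
    exact ⟨o, ⟨a, fun y => (ha y).not_gt⟩, ⟨b, fun y => (hb y).not_gt⟩⟩)
  obtain ⟨w, hw⟩ := hinf.nonempty
  have hwinf : {z | G.chainSetoid w z}.Infinite := hinf.mono fun z hz => ⟨I, hI, hw, hz⟩
  refine not_halfRecon_of_not_hemi (reorder_leHemi (hr := hr) hrT hrC k)
    (reorder_leHemi (hr := hs) hsT hsC k) fun h => ?_
  obtain ⟨e, hclass, hmax⟩ : ∃ e : V ≃ V,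
      (∀ x y, G.chainSetoid x y ↔ G.chainSetoid (e x) (e y)) ∧
      ∃ x, G.chainSetoid w x ∧ ∀ y, G.chainSetoid w y → ¬ (G.reorder r hr).Arc x y := by
    have himage : ∀ e : V ≃ V, (∀ x y, G.chainSetoid x y ↔ G.chainSetoid (e x) (e y)) →
        {z | G.chainSetoid (e w) z}.Infinite := by
      intro e he
      refine (hwinf.image e.injective.injOn).mono ?_
      rintro _ ⟨z, hz, rfl⟩
      exact (he w z).1 hz
    rcases h with ⟨e, he⟩ | ⟨e, he⟩
    · have hc : ∀ x y, G.chainSetoid x y ↔ G.chainSetoid (e x) (e y) := fun x y => by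
        rw [← reorder_chainSetoid (hr := hr) hrT hrC x y, chainSetoid_preimage e he,
          reorder_chainSetoid hsT hsC]
      obtain ⟨-, m, hm⟩ := hsP _ (himage e hc)
      have hwm : G.chainSetoid w (e.symm m.1) := (hc _ _).2 (by rw [Equiv.apply_symm_apply]; exact m.2)
      refine ⟨e, hc, e.symm m.1, hwm, fun y hy h => ?_⟩
      rw [he, Equiv.apply_symm_apply, reorder_arc_of_mem m.2 ((hc w y).1 hy)] at h
      exact hm ⟨e y, (hc w y).1 hy⟩ h
    · have hc : ∀ x y, G.chainSetoid x y ↔ G.chainSetoid (e x) (e y) := fun x y => by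
        rw [← reorder_chainSetoid (hr := hr) hrT hrC x y, ← chainSetoid_dual,
          chainSetoid_preimage e he, reorder_chainSetoid hsT hsC]
      obtain ⟨⟨m, hm⟩, -⟩ := hsP _ (himage e hc)
      have hwm : G.chainSetoid w (e.symm m.1) := (hc _ _).2 (by rw [Equiv.apply_symm_apply]; exact m.2)
      refine ⟨e, hc, e.symm m.1, hwm, fun y hy h => ?_⟩
      have h := (he y (e.symm m.1)).1 h
      rw [Equiv.apply_symm_apply, reorder_arc_of_mem ((hc w y).1 hy) m.2] at h
      exact hm ⟨e y, (hc w y).1 hy⟩ h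
  obtain ⟨x, hx, hmax⟩ := hmax
  obtain ⟨y, hy⟩ := hrP _ hwinf ⟨x, hx⟩
  exact hmax y y.2 ((reorder_arc_of_mem hx y.2).2 hy)

theorem L12Int.isCyclicInterval {G : Dgraph V} {I : Set V} (h : G.L12Int I)
    (hG : ∀ J, G.IsChainInterval J → J.Finite) : G.IsCyclicInterval I := by
  have hD := diamondFreeTournament_ind_iff.1 h.2.1
  refine ⟨h.1, hD, ?_⟩
  by_contra hcyc
  have hchain : G.ChainOn I := by
    refine ⟨hD.1, fun x hx y hy z hz hxy hyz => ?_⟩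
    have hne : x ≠ z := by
      rintro rfl
      exact hD.not_arc hx hy hxy hyz
    rcases hD.1 x hx z hz hne with h' | h'
    · exact h'.1
    · exact (hcyc ⟨x, hx, y, hy, z, hz, hxy, hyz, h'.1⟩).elim
  have := (hG I ⟨h.1, hchain⟩).to_subtype
  have hch := isChainD_ind_iff.2 hchain
  exact h.2.2.1 (hch.iso hch.dual)

theorem not_halfRecon_of_condL1 {G : Dgraph V} (h : G.CondL1) : ¬ G.HalfRecon 6 := by
  by_cases hG : ∀ J, G.IsChainInterval J → J.Finite
  · obtain ⟨I, J, hIJ, hI, hJ⟩ := h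
    exact not_halfRecon_of_cyclicIntervals hIJ (hI.isCyclicInterval hG) (hJ.isCyclicInterval hG)
      hI.2.2.1 hJ.2.2.1
  · push Not at hG
    obtain ⟨J, hJ, hinf⟩ := hG
    exact not_halfRecon_of_infinite_chainInterval hJ hinf 6

end ChainIntervals

end Dgraph

open Dgraph
/-- If a digraph satisfies L1 or L2 then it is not (≤6)-half-reconstructible. -/
theorem not_half_recon_of_L1_or_L2 {V : Type u} (G : Dgraph V)
    (h : G.CondL1 ∨ G.CondL2) : ¬ G.HalfRecon 6 :=
  h.elim not_halfRecon_of_condL1 not_halfRecon_of_condL2
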